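/- Let R = k[x_{ij} : 1 ≤ i ≤ 3, 1 ≤ j ≤ n] with k a field and n ≥ 2. Then ⋂_{1 ≤ a_1 ≤ a_2 < a_3 ≤ n} (x_{1a_1}, x_{2a_2}, x_{3a_3}) equals the ideal generated by the monomials (∏_{i=1}^{k_1} x_{1i})(∏_{i=k_1+1}^{k_2} x_{2i})(∏_{i=k_2+2}^{n} x_{3i}) for all 0 ≤ k_1 ≤ k_2 < n (empty products equal 1). -/

import Mathlib

open MvPolynomial Finset

/-- The index of the entry in row `i`, column `j` (1-based) of an `m × n` matrix of variables. -/
def ent (m n : ℕ) (hm : 0 < m) (hn : 0 < n) (i j : ℕ) : Fin m × Fin n :=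
  (⟨(i - 1) % m, Nat.mod_lt _ hm⟩, ⟨(j - 1) % n, Nat.mod_lt _ hn⟩)

/-- A squarefree monomial divides any monomial whose exponents are nonzero on its support. -/
lemma prod_X_dvd_monomial {σ R : Type*} [CommSemiring R] (T : Finset σ) (m : σ →₀ ℕ) (c : R)
    (h : ∀ v ∈ T, m v ≠ 0) : ∏ v ∈ T, (X v : MvPolynomial σ R) ∣ monomial m c := by
  classical
  have hT : ∏ v ∈ T, (X v : MvPolynomial σ R) = monomial (∑ v ∈ T, Finsupp.single v 1) 1 := by
    rw [monomial_sum_one]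
    rfl
  have hle : ∑ v ∈ T, Finsupp.single v 1 ≤ m := by
    intro v
    rw [Finsupp.finsetSum_apply]
    simp only [Finsupp.single_apply, Finset.sum_ite_eq']
    split_ifs with hv
    · exact Nat.one_le_iff_ne_zero.mpr (h v hv)
    · exact Nat.zero_le _
  rw [hT]
  exact ⟨monomial (m - ∑ v ∈ T, Finsupp.single v 1) c, by
    rw [monomial_mul, one_mul, add_tsub_cancel_of_le hle]⟩

/-- An ideal contains every polynomial all of whose monomials it contains. -/
lemma mem_of_forall_monomial_mem {σ R : Type*} [CommSemiring R] {I : Ideal (MvPolynomial σ R)}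
    {f : MvPolynomial σ R} (h : ∀ m ∈ f.support, monomial m (coeff m f) ∈ I) : f ∈ I := by
  rw [f.as_sum]
  exact I.sum_mem h

lemma exists_maximal_run (P : ℕ → Prop) {a b : ℕ} (hab : a ≤ b) :
    ∃ c, a ≤ c ∧ c ≤ b ∧ (∀ i, a < i → i ≤ c → P i) ∧ (c < b → ¬ P (c + 1)) := by
  induction b, hab using Nat.le_induction with
  | base => exact ⟨a, le_rfl, le_rfl, by omega, by omega⟩
  | succ b hab ih =>
    obtain ⟨c, hac, hcb, hP, hc⟩ := ih
    by_cases hcon : c = b ∧ P (b + 1)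
    · refine ⟨b + 1, by omega, le_rfl, fun i hi hib => ?_, by omega⟩
      obtain rfl | hib' : i = b + 1 ∨ i ≤ c := by omega
      · exact hcon.2
      · exact hP i hi hib'
    · refine ⟨c, hac, by omega, hP, fun hlt hPc => ?_⟩
      obtain hlt' | rfl : c < b ∨ c = b := by omega
      · exact hc hlt' hPc
      · exact hcon ⟨rfl, hPc⟩

lemma exists_cover_of_forall_chain {n : ℕ} (hn : 0 < n) (A B C : ℕ → Prop)
    (h : ∀ a b c, 1 ≤ a → a ≤ b → b < c → c ≤ n → A a ∨ B b ∨ C c) :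
    ∃ p q, p ≤ q ∧ q < n ∧ (∀ i ∈ Finset.Icc 1 p, A i) ∧ (∀ i ∈ Finset.Icc (p + 1) q, B i) ∧
      ∀ i ∈ Finset.Icc (q + 2) n, C i := by
  obtain ⟨p, -, hpn, hA, hA'⟩ := exists_maximal_run A (show 0 ≤ n - 1 by omega)
  obtain ⟨q, hpq, hqn, hB, hB'⟩ := exists_maximal_run B hpn
  simp only [Finset.mem_Icc]
  refine ⟨p, q, hpq, by omega, fun i hi => hA i (by omega) hi.2,
    fun i hi => hB i (by omega) hi.2, fun i hi => ?_⟩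
  have := h (p + 1) (q + 1) i (by omega) (by omega) (by omega) hi.2
  exact (this.resolve_left (hA' (by omega))).resolve_left (hB' (by omega))

lemma ent_inj_of_mem_Icc {m n : ℕ} (hm : 0 < m) (hn : 0 < n) {i j i' j' : ℕ}
    (hi : i ∈ Finset.Icc 1 m) (hj : j ∈ Finset.Icc 1 n) (hi' : i' ∈ Finset.Icc 1 m)
    (hj' : j' ∈ Finset.Icc 1 n) (h : ent m n hm hn i j = ent m n hm hn i' j') :
    i = i' ∧ j = j' := by
  simp only [Finset.mem_Icc] at hi hj hi' hj'
  simp only [ent, Prod.mk.injEq, Fin.mk.injEq] at h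
  rw [Nat.mod_eq_of_lt (by omega), Nat.mod_eq_of_lt (by omega), Nat.mod_eq_of_lt (by omega),
    Nat.mod_eq_of_lt (by omega)] at h
  omega

/-- In `k[x_{ij} : 1 ≤ i ≤ 3, 1 ≤ j ≤ n]`, the intersection
`⋂_{1 ≤ a₁ ≤ a₂ < a₃ ≤ n} (x_{1a₁}, x_{2a₂}, x_{3a₃})` equals the ideal generated by the
monomials `(∏_{i=1}^{k₁} x_{1i})(∏_{i=k₁+1}^{k₂} x_{2i})(∏_{i=k₂+2}^{n} x_{3i})` for all
`0 ≤ k₁ ≤ k₂ < n`. -/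
theorem alexanderDual_three_rows (k : Type*) [Field k] (n : ℕ) (hn : 2 ≤ n) :
    (⨅ (a₁ : ℕ) (a₂ : ℕ) (a₃ : ℕ) (_ : 1 ≤ a₁ ∧ a₁ ≤ a₂ ∧ a₂ < a₃ ∧ a₃ ≤ n),
      Ideal.span {(X (ent 3 n (by omega) (by omega) 1 a₁) : MvPolynomial (Fin 3 × Fin n) k),
        X (ent 3 n (by omega) (by omega) 2 a₂), X (ent 3 n (by omega) (by omega) 3 a₃)}) =
    Ideal.span {g : MvPolynomial (Fin 3 × Fin n) k | ∃ k₁ k₂ : ℕ, k₁ ≤ k₂ ∧ k₂ < n ∧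
      g = (∏ i ∈ Finset.Icc 1 k₁, X (ent 3 n (by omega) (by omega) 1 i)) *
          (∏ i ∈ Finset.Icc (k₁ + 1) k₂, X (ent 3 n (by omega) (by omega) 2 i)) *
          ∏ i ∈ Finset.Icc (k₂ + 2) n, X (ent 3 n (by omega) (by omega) 3 i)} := by
  have hn0 : 0 < n := by omega
  apply le_antisymm
  · intro f hf
    simp only [Ideal.mem_iInf] at hf
    refine mem_of_forall_monomial_mem fun m hm => ?_
    obtain ⟨p, q, hpq, hqn, h₁, h₂, h₃⟩ := exists_cover_of_forall_chain hn0
      (fun j => m (ent 3 n (by omega) hn0 1 j) ≠ 0) (fun j => m (ent 3 n (by omega) hn0 2 j) ≠ 0)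
      (fun j => m (ent 3 n (by omega) hn0 3 j) ≠ 0) (fun a b c ha hab hbc hc => by
        have hmem := hf a b c ⟨ha, hab, hbc, hc⟩
        rw [← Set.image_singleton, ← Set.image_insert_eq, ← Set.image_insert_eq,
          mem_ideal_span_X_image] at hmem
        simpa using hmem m hm)
    refine Ideal.mem_of_dvd _ ?_ (Ideal.subset_span ⟨p, q, hpq, hqn, rfl⟩)
    have hinj : ∀ r ∈ Finset.Icc 1 3, ∀ s ⊆ Finset.Icc 1 n,
        Set.InjOn (ent 3 n (by omega) hn0 r) (s : Set ℕ) := fun r hr s hs x hx y hy hxy =>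
      (ent_inj_of_mem_Icc _ _ hr (hs hx) hr (hs hy) hxy).2
    have hdisj : ∀ r ∈ Finset.Icc 1 3, ∀ r' ∈ Finset.Icc 1 3, r ≠ r' →
        ∀ s ⊆ Finset.Icc 1 n, ∀ t ⊆ Finset.Icc 1 n,
        Disjoint (s.image (ent 3 n (by omega) hn0 r)) (t.image (ent 3 n (by omega) hn0 r')) := by
      intro r hr r' hr' hne s hs t ht
      simp only [Finset.disjoint_left, Finset.mem_image]
      rintro _ ⟨x, hx, rfl⟩ ⟨y, hy, hxy⟩
      exact hne (ent_inj_of_mem_Icc _ _ hr' (ht hy) hr (hs hx) hxy).1.symm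
    have hs₁ : Finset.Icc 1 p ⊆ Finset.Icc 1 n := Finset.Icc_subset_Icc le_rfl (by omega)
    have hs₂ : Finset.Icc (p + 1) q ⊆ Finset.Icc 1 n :=
      Finset.Icc_subset_Icc (by omega) (by omega)
    have hs₃ : Finset.Icc (q + 2) n ⊆ Finset.Icc 1 n := Finset.Icc_subset_Icc (by omega) le_rfl
    rw [← Finset.prod_image (f := X) (hinj 1 (by simp) _ hs₁),
      ← Finset.prod_image (f := X) (hinj 2 (by simp) _ hs₂),
      ← Finset.prod_image (f := X) (hinj 3 (by simp) _ hs₃),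
      ← Finset.prod_union (hdisj 1 (by simp) 2 (by simp) (by simp) _ hs₁ _ hs₂),
      ← Finset.prod_union (Finset.disjoint_union_left.mpr
        ⟨hdisj 1 (by simp) 3 (by simp) (by simp) _ hs₁ _ hs₃,
          hdisj 2 (by simp) 3 (by simp) (by simp) _ hs₂ _ hs₃⟩)]
    refine prod_X_dvd_monomial _ m _ fun v hv => ?_
    simp only [Finset.mem_union, Finset.mem_image] at hv
    obtain (⟨j, hj, rfl⟩ | ⟨j, hj, rfl⟩) | ⟨j, hj, rfl⟩ := hv
    exacts [h₁ j hj, h₂ j hj, h₃ j hj]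
  · rw [Ideal.span_le]
    rintro _ ⟨p, q, hpq, hqn, rfl⟩
    simp only [SetLike.mem_coe, Ideal.mem_iInf]
    rintro a b c ⟨ha, hab, hbc, hc⟩
    obtain h | h | h : a ∈ Finset.Icc 1 p ∨ b ∈ Finset.Icc (p + 1) q ∨
        c ∈ Finset.Icc (q + 2) n := by
      simp only [Finset.mem_Icc]
      omega
    · exact Ideal.mem_of_dvd _ (((Finset.dvd_prod_of_mem _ h).mul_right _).mul_right _)
        (Ideal.subset_span (by simp))
    · exact Ideal.mem_of_dvd _ (((Finset.dvd_prod_of_mem _ h).mul_left _).mul_right _)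
        (Ideal.subset_span (by simp))
    · exact Ideal.mem_of_dvd _ ((Finset.dvd_prod_of_mem _ h).mul_left _)
        (Ideal.subset_span (by simp))
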